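/- Let d ≥ 1, p ≥ 2 be integers, ε, δ, β ∈ (0,1), and n ≥ t ≥ 1 integers. Set Γ = 8^{log*(2p√d)}·(144·log*(2p√d)/ε)·log₂(24·log*(2p√d)/(βδ)). Then there exists an (ε,δ)-differentially private algorithm mapping databases S ∈ (X^d)^n to probability measures on ℝ_{≥0} such that for every S, with probability at least 1−β the output r satisfies: (1) some closed Euclidean ball of radius r centered at a point of X^d contains at least t − 4Γ − (4/ε)·ln(1/β) entries of S (with multiplicity); and (2) r ≤ 4·r_opt, where r_opt is the minimal radius of a closed ball centered at a point of X^d containing at least t entries of S. -/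

import Mathlib

open MeasureTheory
open scoped NNReal ENNReal

/-- Iterated logarithm (base 2). -/
noncomputable def logStar (x : ℝ) : ℕ := sInf {k : ℕ | (Real.logb 2)^[k] x ≤ 1}

/-- The grid `X = {0, 1/(p-1), …, 1} ⊆ ℝ` with `p ≥ 2` equally spaced points. -/
def gridSet (p : ℕ) : Set ℝ := {x : ℝ | ∃ j : ℕ, j ≤ p - 1 ∧ x = (j : ℝ) / ((p : ℝ) - 1)}

/-- Number of entries of the database `S` inside the closed ball of radius `r` around `c`. -/
noncomputable def ballCount {d n : ℕ} (S : Fin n → EuclideanSpace ℝ (Fin d))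
    (c : EuclideanSpace ℝ (Fin d)) (r : ℝ) : ℕ :=
  Nat.card {i : Fin n // dist (S i) c ≤ r}

/-- The minimal radius of a closed ball centered at a point of the grid `X^d`
containing at least `t` entries of `S`. -/
noncomputable def rOpt {d n : ℕ} (p : ℕ) (S : Fin n → EuclideanSpace ℝ (Fin d)) (t : ℕ) : ℝ :=
  sInf {r : ℝ | 0 ≤ r ∧ ∃ c : EuclideanSpace ℝ (Fin d), (∀ j, c j ∈ gridSet p) ∧ t ≤ ballCount S c r}

/-- `(ε,δ)`-differential privacy for databases whose entries all lie in `A`. -/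
def IsDPOn {U Ω : Type*} [MeasurableSpace Ω] {n : ℕ} (A : Set U)
    (M : (Fin n → U) → Measure Ω) (ε δ : ℝ) : Prop :=
  ∀ S S' : Fin n → U, (∀ i, S i ∈ A) → (∀ i, S' i ∈ A) →
    (∃ i₀, S i₀ ≠ S' i₀ ∧ ∀ j, j ≠ i₀ → S j = S' j) →
    ∀ T : Set Ω, MeasurableSet T →
      M S T ≤ ENNReal.ofReal (Real.exp ε) * M S' T + ENNReal.ofReal δ

/-- `(c, δ)`-closeness of discrete distributions, tested against `[0,1]`-valued functions. -/
def PMFClose {α : Type*} (c δ : ℝ≥0∞) (p q : PMF α) : Prop :=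
  ∀ h : α → ℝ≥0∞, (∀ x, h x ≤ 1) → ∑' x, p x * h x ≤ c * ∑' x, q x * h x + δ

lemma tsum_bind_mul {α γ : Type*} (p : PMF α) (k : α → PMF γ) (h : γ → ℝ≥0∞) :
    ∑' y, (p.bind k) y * h y = ∑' x, p x * ∑' y, k x y * h y := by
  simp only [PMF.bind_apply, ← ENNReal.tsum_mul_right, ← ENNReal.tsum_mul_left]
  rw [ENNReal.tsum_comm]
  simp only [mul_assoc]

lemma tsum_map_mul {α γ : Type*} (p : PMF α) (f : α → γ) (h : γ → ℝ≥0∞) :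
    ∑' y, (p.map f) y * h y = ∑' x, p x * h (f x) := by
  rw [← PMF.bind_pure_comp, tsum_bind_mul]
  refine tsum_congr fun x => ?_
  congr 1
  rw [tsum_eq_single (f x)]
  · simp
  · intro y hy
    simp [hy]

lemma tsum_mul_le_one {α : Type*} (p : PMF α) (h : α → ℝ≥0∞) (hh : ∀ x, h x ≤ 1) :
    ∑' x, p x * h x ≤ 1 := by
  calc ∑' x, p x * h x ≤ ∑' x, p x :=
        ENNReal.tsum_le_tsum fun x => mul_le_of_le_one_right' (hh x)
    _ = 1 := p.tsum_coe

lemma PMFClose.refl {α : Type*} (p : PMF α) : PMFClose 1 0 p p := by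
  intro h _
  simp

/-- Adaptive composition; the second-stage kernels only need to be close where both first-stage
distributions have mass. -/
lemma PMFClose.bind {α γ : Type*} {c₁ δ₁ c₂ δ₂ : ℝ≥0∞} {p q : PMF α} {k l : α → PMF γ}
    (hpq : PMFClose c₁ δ₁ p q)
    (hkl : ∀ x ∈ p.support, x ∈ q.support → PMFClose c₂ δ₂ (k x) (l x)) :
    PMFClose (c₁ * c₂) (δ₁ + δ₂) (p.bind k) (q.bind l) := by
  classical
  intro h hh
  rw [tsum_bind_mul, tsum_bind_mul]
  let H : α → ℝ≥0∞ := fun x => if q x = 0 then 1 else min 1 (c₂ * ∑' y, l x y * h y)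
  have hH : ∀ x, H x ≤ 1 := by
    intro x
    simp only [H]
    split_ifs
    · exact le_rfl
    · exact min_le_left _ _
  have h1 : ∀ x, p x * ∑' y, k x y * h y ≤ p x * H x + p x * δ₂ := by
    intro x
    by_cases hp : p x = 0
    · simp [hp]
    rw [← mul_add]
    gcongr
    have hk1 := tsum_mul_le_one (k x) h hh
    simp only [H]
    split_ifs with hq
    · exact hk1.trans le_self_add
    · have h2 := hkl x ((PMF.mem_support_iff _ _).2 hp) ((PMF.mem_support_iff _ _).2 hq) h hh
      rcases le_total 1 (c₂ * ∑' y, l x y * h y) with h3 | h3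
      · rw [min_eq_left h3]
        exact hk1.trans le_self_add
      · rw [min_eq_right h3]
        exact h2
  have h2 : ∀ x, q x * H x ≤ c₂ * (q x * ∑' y, l x y * h y) := by
    intro x
    by_cases hq : q x = 0
    · simp [hq]
    · simp only [H, hq, if_false]
      rw [mul_left_comm]
      gcongr
      exact min_le_right _ _
  calc ∑' x, p x * ∑' y, k x y * h y ≤ ∑' x, (p x * H x + p x * δ₂) :=
        ENNReal.tsum_le_tsum h1
    _ = ∑' x, p x * H x + δ₂ := by
        rw [ENNReal.tsum_add, ENNReal.tsum_mul_right, p.tsum_coe, one_mul]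
    _ ≤ c₁ * ∑' x, q x * H x + δ₁ + δ₂ := by
        gcongr
        exact hpq H hH
    _ ≤ c₁ * ∑' x, c₂ * (q x * ∑' y, l x y * h y) + δ₁ + δ₂ := by
        refine add_le_add (add_le_add (mul_le_mul' le_rfl ?_) le_rfl) le_rfl
        exact ENNReal.tsum_le_tsum h2
    _ = c₁ * c₂ * ∑' x, q x * ∑' y, l x y * h y + (δ₁ + δ₂) := by
        rw [ENNReal.tsum_mul_left, mul_assoc, add_assoc]

/-- A distribution on `{0, …, W}` that is `(c, δ)`-close to its shift by one. -/
structure IsShiftNoise (ν : PMF ℕ) (W : ℕ) (c δ : ℝ≥0∞) : Prop where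
  le_of_mem_support : ∀ z ∈ ν.support, z ≤ W
  shift_right : ∀ h : ℕ → ℝ≥0∞, (∀ x, h x ≤ 1) →
    ∑' z, ν z * h z ≤ c * ∑' z, ν z * h (z + 1) + δ
  shift_left : ∀ h : ℕ → ℝ≥0∞, (∀ x, h x ≤ 1) →
    ∑' z, ν z * h (z + 1) ≤ c * ∑' z, ν z * h z + δ

/-- The two-sided truncated geometric distribution is a shift noise. -/
lemma exists_isShiftNoise (R : ℕ) (c δ : ℝ≥0∞) (hc : 1 ≤ c) (hc' : c ≠ ⊤)
    (hδ : (c ^ R)⁻¹ ≤ δ) : ∃ ν : PMF ℕ, IsShiftNoise ν (2 * R) c δ := by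
  let w : ℕ → ℝ≥0∞ := fun z => if z ≤ 2 * R then c ^ (min z (2 * R - z)) else 0
  have hc0 : c ≠ 0 := fun h => by simp [h] at hc
  have hwR : w R = c ^ R := by
    simp only [w]
    rw [if_pos (by omega)]
    congr 1
    omega
  have hle : c ^ R ≤ ∑' z, w z := hwR ▸ ENNReal.le_tsum R
  have h0 : ∑' z, w z ≠ 0 := by
    intro h
    rw [h] at hle
    exact pow_ne_zero R hc0 (le_antisymm hle (zero_le))
  have htop : ∑' z, w z ≠ ⊤ := by
    rw [tsum_eq_sum (s := Finset.range (2 * R + 1))]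
    · refine ENNReal.sum_ne_top.2 fun z _ => ?_
      simp only [w]
      split_ifs
      · exact ENNReal.pow_ne_top hc'
      · simp
    · intro z hz
      simp only [w]
      rw [if_neg]
      simpa using hz
  let ν := PMF.normalize w h0 htop
  have hν : ∀ z, ν z = w z * (∑' z, w z)⁻¹ := fun z => PMF.normalize_apply h0 htop z
  have hend : ∀ z, w z = 1 → ν z ≤ δ := by
    intro z hz
    rw [hν, hz, one_mul]
    exact (ENNReal.inv_le_inv.2 hle).trans hδ
  have hup : ∀ z, ν (z + 1) ≤ c * ν z := by
    intro z
    rw [hν, hν, ← mul_assoc]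
    gcongr
    simp only [w]
    split_ifs with h1 h2
    · rw [← pow_succ']
      exact pow_le_pow_right₀ hc (by omega)
    · omega
    · exact zero_le
    · exact zero_le
  have hdown : ∀ z, z ≠ 2 * R → ν z ≤ c * ν (z + 1) := by
    intro z hz
    rw [hν, hν, ← mul_assoc]
    gcongr
    simp only [w]
    split_ifs with h1 h2
    · rw [← pow_succ']
      exact pow_le_pow_right₀ hc (by omega)
    · omega
    · exact zero_le
    · exact zero_le
  refine ⟨ν, ⟨?_, ?_, ?_⟩⟩
  · intro z hz
    by_contra hlt
    rw [PMF.mem_support_iff, hν] at hz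
    simp [w, hlt] at hz
  · intro h hh
    rw [tsum_eq_zero_add' ENNReal.summable, add_comm, ← ENNReal.tsum_mul_left]
    refine add_le_add (ENNReal.tsum_le_tsum fun z => ?_) ?_
    · rw [← mul_assoc]
      gcongr
      exact hup z
    · refine (mul_le_of_le_one_right' (hh 0)).trans (hend 0 ?_)
      simp [w]
  · intro h hh
    have hz : ∀ z, ν z * h (z + 1) ≤
        c * (ν (z + 1) * h (z + 1)) + (if z = 2 * R then δ else 0) := by
      intro z
      by_cases hz : z = 2 * R
      · rw [if_pos hz]
        refine le_add_left ((mul_le_of_le_one_right' (hh _)).trans (hend z ?_))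
        simp [w, hz]
      · rw [if_neg hz, add_zero, ← mul_assoc]
        gcongr
        exact hdown z hz
    refine (ENNReal.tsum_le_tsum hz).trans ?_
    rw [ENNReal.tsum_add, tsum_ite_eq, ENNReal.tsum_mul_left]
    refine add_le_add (mul_le_mul' le_rfl ?_) le_rfl
    rw [tsum_eq_zero_add' (f := fun z => ν z * h z) ENNReal.summable]
    exact le_add_self

lemma interleaved_two_valued_cases {W : ℕ} {g g' : ℕ → ℕ} (hg : Monotone g) (hg' : Monotone g')
    (hW : g W ≤ g 0 + 1) (hW' : g' W ≤ g' 0 + 1)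
    (h : ∀ z, g z ≤ g' (z + 1)) (h' : ∀ z, g' z ≤ g (z + 1)) :
    (∀ z < W, g (z + 1) = g' z) ∨ (∀ z < W, g z = g' (z + 1)) ∨ ∀ z ≤ W, g z = g' z := by
  by_contra! hne
  obtain ⟨⟨y, hyW, hy⟩, ⟨z, hzW, hz⟩, ⟨u, huW, hu⟩⟩ := hne
  have hy' := lt_of_le_of_ne (h' y) hy.symm
  have hz' := lt_of_le_of_ne (h z) hz
  have b : ∀ x ≤ W, g 0 ≤ g x ∧ g x ≤ g W ∧ g' 0 ≤ g' x ∧ g' x ≤ g' W := fun x hx =>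
    ⟨hg (Nat.zero_le _), hg hx, hg' (Nat.zero_le _), hg' hx⟩
  have b1 := b y hyW.le
  have b2 := b (y + 1) hyW
  have b3 := b z hzW.le
  have b4 := b (z + 1) hzW
  have b5 := b u huW
  have hyz : y = z := by
    rcases lt_trichotomy y z with hlt | heq | hlt
    · have := hg (show y + 1 ≤ z by omega)
      omega
    · exact heq
    · have := hg' (show z + 1 ≤ y by omega)
      omega
  subst hyz
  rcases Nat.lt_or_ge y u with hlt | hge
  · have e1 := hg (show y + 1 ≤ u by omega)
    have e2 := hg' (show y + 1 ≤ u by omega)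
    omega
  · have e1 := hg hge
    have e2 := hg' hge
    omega

/-- Evaluating a monotone two-valued step function at a random level is private with respect to
interleaving. -/
lemma IsShiftNoise.map_close {ν : PMF ℕ} {W : ℕ} {c δ : ℝ≥0∞} (hν : IsShiftNoise ν W c δ)
    (hc : 1 ≤ c) {g g' : ℕ → ℕ} (hg : Monotone g) (hg' : Monotone g')
    (hW : g W ≤ g 0 + 1) (hW' : g' W ≤ g' 0 + 1)
    (h : ∀ z, g z ≤ g' (z + 1)) (h' : ∀ z, g' z ≤ g (z + 1)) :
    PMFClose c δ (ν.map g) (ν.map g') := by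
  intro f hf
  rw [tsum_map_mul, tsum_map_mul]
  have hcongr : ∀ u v : ℕ → ℝ≥0∞, (∀ z ≤ W, u z = v z) →
      ∑' z, ν z * u z = ∑' z, ν z * v z := by
    intro u v huv
    refine tsum_congr fun z => ?_
    by_cases hz : ν z = 0
    · simp [hz]
    · rw [huv z (hν.le_of_mem_support z ((PMF.mem_support_iff _ _).2 hz))]
  rcases interleaved_two_valued_cases hg hg' hW hW' h h' with hs | hs | hs
  · let u : ℕ → ℝ≥0∞ := fun z => if z ≤ W then f (g z) else f (g' (z - 1))
    have hu : ∀ z, u z ≤ 1 := by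
      intro z
      simp only [u]
      split_ifs <;> exact hf _
    have e1 := hν.shift_right u hu
    rw [hcongr u (fun z => f (g z)) (fun z hz => by simp [u, hz]),
      hcongr (fun z => u (z + 1)) (fun z => f (g' z)) (fun z hz => by
        by_cases hzW : z + 1 ≤ W
        · simp [u, hzW, hs z hzW]
        · simp [u, hzW])] at e1
    exact e1
  · let u : ℕ → ℝ≥0∞ := fun z => if z ≤ W then f (g' z) else f (g (z - 1))
    have hu : ∀ z, u z ≤ 1 := by
      intro z
      simp only [u]
      split_ifs <;> exact hf _
    have e1 := hν.shift_left u hu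
    rw [hcongr u (fun z => f (g' z)) (fun z hz => by simp [u, hz]),
      hcongr (fun z => u (z + 1)) (fun z => f (g z)) (fun z hz => by
        by_cases hzW : z + 1 ≤ W
        · simp [u, hzW, hs z hzW]
        · simp [u, hzW])] at e1
    exact e1
  · rw [hcongr (fun z => f (g z)) (fun z => f (g' z)) fun z hz => by rw [hs z hz]]
    exact (le_mul_of_one_le_left' hc).trans le_self_add

/-- Each of two functions on levels is bounded by the other one shifted by one level. -/
def Interleaved (a b : ℤ → ℕ) : Prop := ∀ s, a s ≤ b (s + 1) ∧ b s ≤ a (s + 1)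

/-- The number of levels used by `k` rounds of logarithmic reduction with noise radius `R`. -/
def numLevels (R : ℕ) : ℕ → ℕ
  | 0 => 2 * R
  | k + 1 => 2 * (3 * R + numLevels R k)

lemma numLevels_le (R k : ℕ) : numLevels R k + 6 * R = 2 ^ k * (8 * R) := by
  induction k with
  | zero => simp [numLevels]; ring
  | succ k ih =>
    rw [numLevels, pow_succ]
    linarith

/-- The scale, in powers of two, of the central window of radius `q` around level `m`. -/
def logWidth (a : ℤ → ℕ) (m q : ℤ) : ℕ := Nat.log 2 (a (m + q) - a (m - q))

lemma logWidth_mono {a : ℤ → ℕ} (ha : Monotone a) (m : ℤ) : Monotone (logWidth a m) := by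
  intro q q' hq
  exact Nat.log_mono_right
    (tsub_le_tsub (ha (by omega)) (ha (by omega)))

lemma Interleaved.logWidth {a b : ℤ → ℕ} (h : Interleaved a b) (m : ℤ) :
    Interleaved (logWidth a m) (logWidth b m) := by
  have key : ∀ {a b : ℤ → ℕ}, Interleaved a b → ∀ s, _root_.logWidth a m s ≤
      _root_.logWidth b m (s + 1) := by
    intro a b h s
    refine Nat.log_mono_right (tsub_le_tsub ?_ ?_)
    · have := (h (m + s)).1
      rwa [add_assoc] at this
    · have := (h (m - (s + 1))).2
      rwa [show m - (s + 1) + 1 = m - s by ring] at this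
  exact fun s => ⟨key h s, key (fun s => (h s).symm) s⟩

/-- Given a scale `j`, locate a cell of length `2 ^ (j + 1)` near the central levels of `a`, then
choose between the end points and the midpoint of this cell by two noisy comparisons. -/
noncomputable def refineAtScale (ν : PMF ℕ) (b : ℤ) (a : ℤ → ℕ) (j : ℕ) : PMF ℕ :=
  (ν.map fun z : ℕ => a (b + z) / 2 ^ (j + 1)).bind fun q =>
    (ν.map fun z : ℕ => if q * 2 ^ (j + 1) < a z then 1 else 0).bind fun u =>
      (ν.map fun z : ℕ => if q * 2 ^ (j + 1) + 2 ^ j < a z then 1 else 0).bind fun v =>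
        PMF.pure (if u = 0 then q * 2 ^ (j + 1)
          else if v = 0 then q * 2 ^ (j + 1) + 2 ^ j else q * 2 ^ (j + 1) + 2 * 2 ^ j)

lemma div_le_div_add_one {x y L : ℕ} (hL : 0 < L) (h : x < y + L) : x / L ≤ y / L + 1 := by
  rw [← Nat.add_div_right y hL]
  exact Nat.div_le_div_right h.le

lemma IsShiftNoise.compare_close {ν : PMF ℕ} {W : ℕ} {c δ : ℝ≥0∞} (hν : IsShiftNoise ν W c δ)
    (hc : 1 ≤ c) {a a' : ℤ → ℕ} (ha : Monotone a) (ha' : Monotone a') (h : Interleaved a a')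
    (x : ℕ) : PMFClose c δ (ν.map fun z : ℕ => if x < a z then 1 else 0)
      (ν.map fun z : ℕ => if x < a' z then 1 else 0) := by
  have mono : ∀ {f : ℤ → ℕ}, Monotone f → Monotone fun z : ℕ => if x < f z then 1 else 0 := by
    intro f hf y z hyz
    have := hf (show (y : ℤ) ≤ z by exact_mod_cast hyz)
    dsimp only
    split_ifs <;> omega
  refine hν.map_close hc (mono ha) (mono ha') ?_ ?_ ?_ ?_
  · split_ifs <;> omega
  · split_ifs <;> omega
  · intro z
    have := (h z).1
    push_cast
    split_ifs <;> omega
  · intro z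
    have := (h z).2
    push_cast
    split_ifs <;> omega

lemma IsShiftNoise.refineAtScale_close {ν : PMF ℕ} {W : ℕ} {c δ : ℝ≥0∞}
    (hν : IsShiftNoise ν W c δ) (hc : 1 ≤ c) {a a' : ℤ → ℕ} (ha : Monotone a)
    (ha' : Monotone a') (h : Interleaved a a') (b : ℤ) (j : ℕ)
    (hj : a (b + W) < a b + 2 ^ (j + 1)) (hj' : a' (b + W) < a' b + 2 ^ (j + 1)) :
    PMFClose (c ^ 3) (3 * δ) (refineAtScale ν b a j) (refineAtScale ν b a' j) := by
  have hcell : PMFClose c δ (ν.map fun z : ℕ => a (b + z) / 2 ^ (j + 1))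
      (ν.map fun z : ℕ => a' (b + z) / 2 ^ (j + 1)) := by
    have mono : ∀ {f : ℤ → ℕ}, Monotone f → Monotone fun z : ℕ => f (b + z) / 2 ^ (j + 1) := by
      intro f hf y z hyz
      exact Nat.div_le_div_right (hf (by omega))
    refine hν.map_close hc (mono ha) (mono ha') ?_ ?_ ?_ ?_
    · exact div_le_div_add_one (by positivity) (by simpa using hj)
    · exact div_le_div_add_one (by positivity) (by simpa using hj')
    · intro z
      refine Nat.div_le_div_right ?_
      have := (h (b + z)).1
      push_cast
      rwa [← add_assoc]
    · intro z
      refine Nat.div_le_div_right ?_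
      have := (h (b + z)).2
      push_cast
      rwa [← add_assoc]
  have := hcell.bind (c₂ := c * (c * 1)) (δ₂ := δ + (δ + 0))
    fun q _ _ => (hν.compare_close hc ha ha' h (q * 2 ^ (j + 1))).bind
      fun u _ _ => (hν.compare_close hc ha ha' h (q * 2 ^ (j + 1) + 2 ^ j)).bind
        fun v _ _ => PMFClose.refl (PMF.pure (if u = 0 then q * 2 ^ (j + 1)
          else if v = 0 then q * 2 ^ (j + 1) + 2 ^ j else q * 2 ^ (j + 1) + 2 * 2 ^ j))
  rw [show c ^ 3 = c * (c * (c * 1)) by ring, show 3 * δ = δ + (δ + (δ + 0)) by ring]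
  exact this

lemma refineAtScale_mem {ν : PMF ℕ} {W : ℕ} (hν : ∀ z ∈ ν.support, z ≤ W) {a : ℤ → ℕ}
    (ha : Monotone a) {b l u t : ℤ} {j : ℕ} (hWl : (W : ℤ) ≤ l) (hlb : l ≤ b) (hbu : b + W ≤ u)
    (hut : u ≤ t) (hj : j = 0 ∨ a l + 2 ^ j ≤ a u) :
    ∀ x ∈ (refineAtScale ν b a j).support, a 0 ≤ x ∧ x ≤ a t := by
  intro x hx
  simp only [refineAtScale, PMF.mem_support_bind_iff, PMF.mem_support_map_iff,
    PMF.mem_support_pure_iff] at hx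
  obtain ⟨q, ⟨z, hz, rfl⟩, v, ⟨y, hy, rfl⟩, w, ⟨y', hy', rfl⟩, rfl⟩ := hx
  have hz := hν z hz
  have hy := hν y hy
  have hy' := hν y' hy'
  have h0y : a 0 ≤ a y := ha (by omega)
  have h0y' : a 0 ≤ a y' := ha (by omega)
  have hyl : a y ≤ a l := ha (by omega)
  have hyl' : a y' ≤ a l := ha (by omega)
  have hlz : a l ≤ a (b + z) := ha (by omega)
  have hzu : a (b + z) ≤ a u := ha (by omega)
  have hut : a u ≤ a t := ha hut
  have hd := Nat.div_add_mod (a (b + z)) (2 ^ (j + 1))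
  have hm := Nat.mod_lt (a (b + z)) (show 0 < 2 ^ (j + 1) by positivity)
  rw [mul_comm] at hd
  have hj : 2 ^ j = 1 ∨ a l + 2 ^ j ≤ a u := hj.imp (fun h => by simp [h]) id
  have hP : 2 ^ (j + 1) = 2 * 2 ^ j := pow_succ' 2 j
  generalize a (b + z) / 2 ^ (j + 1) * 2 ^ (j + 1) = X at *
  generalize a (b + z) % 2 ^ (j + 1) = r at *
  rw [hP] at hm
  generalize 2 ^ j = P at *
  split_ifs <;> first | contradiction | omega

/-- Private selection of a point between the lowest and the highest level of a bounded monotone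
function, for functions whose range collapses after `k` logarithms. -/
theorem exists_interior {ν : PMF ℕ} {R : ℕ} {c δ : ℝ≥0∞} (hν : IsShiftNoise ν (2 * R) c δ)
    (hc : 1 ≤ c) (k N : ℕ) (hN : (Nat.log 2)^[k] N ≤ 1) :
    ∃ A : (ℤ → ℕ) → PMF ℕ,
      (∀ a, Monotone a → (∀ s, a s ≤ N) → ∀ x ∈ (A a).support,
        a 0 ≤ x ∧ x ≤ a (numLevels R k)) ∧
      ∀ a a', Monotone a → (∀ s, a s ≤ N) → Monotone a' → (∀ s, a' s ≤ N) → Interleaved a a' →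
        PMFClose (c ^ (3 * k + 1)) ((3 * k + 1 : ℕ) * δ) (A a) (A a') := by
  induction k generalizing N with
  | zero =>
    simp only [Function.iterate_zero, id] at hN
    refine ⟨fun a => ν.map fun z : ℕ => a z, ?_, ?_⟩
    · intro a ha _ x hx
      rw [PMF.mem_support_map_iff] at hx
      obtain ⟨z, hz, rfl⟩ := hx
      have := hν.le_of_mem_support z hz
      exact ⟨ha (by omega), ha (by simp only [numLevels]; omega)⟩
    · intro a a' ha hN1 ha' hN2 h
      have mono : ∀ {f : ℤ → ℕ}, Monotone f → Monotone fun z : ℕ => f z := fun hf y z hyz =>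
        hf (by omega)
      have := hν.map_close hc (mono ha) (mono ha') (by have := hN1 (2 * R : ℕ); omega)
        (by have := hN2 (2 * R : ℕ); omega) (fun z => by exact_mod_cast (h z).1)
        (fun z => by exact_mod_cast (h z).2)
      simpa using this
  | succ k ih =>
    obtain ⟨A, hA, hA'⟩ := ih (Nat.log 2 N) hN
    set G := numLevels R k with hG
    let m : ℤ := 3 * R + G
    let f : (ℤ → ℕ) → ℤ → ℕ := fun a s => logWidth a m (R + s)
    have hf : ∀ {a : ℤ → ℕ}, Monotone a → Monotone (f a) := fun ha y z hyz =>
      logWidth_mono ha m (by omega)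
    have hfN : ∀ {a : ℤ → ℕ}, (∀ s, a s ≤ N) → ∀ s, f a s ≤ Nat.log 2 N := fun ha s =>
      Nat.log_mono_right ((Nat.sub_le _ _).trans (ha _))
    refine ⟨fun a => (A (f a)).bind (refineAtScale ν (m - R) a), ?_, ?_⟩
    · intro a ha haN x hx
      rw [PMF.mem_support_bind_iff] at hx
      obtain ⟨j, hj, hx⟩ := hx
      have hj := (hA _ (hf ha) (hfN haN) j hj).2
      refine refineAtScale_mem hν.le_of_mem_support ha (l := m - (R + G)) (u := m + (R + G))
        ?_ ?_ ?_ ?_ ?_ x hx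
      · simp only [m]; push_cast; omega
      · omega
      · push_cast; omega
      · simp only [m, numLevels]; push_cast; omega
      · by_cases h0 : j = 0
        · exact Or.inl h0
        · right
          have h1 := Nat.pow_le_of_le_log (b := 2) (y := a (m + (R + G)) - a (m - (R + G)))
            (x := j) ?_ hj
          · have : 0 < 2 ^ j := by positivity
            omega
          · intro hz
            simp only [f, logWidth, hz] at hj
            simp at hj
            exact h0 hj
    · intro a a' ha haN ha' haN' h
      have hwin : ∀ {a : ℤ → ℕ} {j : ℕ}, f a 0 ≤ j →
          a (m - R + (2 * R : ℕ)) < a (m - R) + 2 ^ (j + 1) := by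
        intro a j hj
        have := Nat.lt_pow_of_log_lt (b := 2) (by norm_num) (Nat.lt_succ_of_le hj)
        rw [show m - R + (2 * R : ℕ) = m + (R + 0) by push_cast; ring]
        simp only [add_zero] at this ⊢
        rw [Nat.succ_eq_add_one] at this
        omega
      have := (hA' (f a) (f a') (hf ha) (hfN haN) (hf ha') (hfN haN') (fun s => by
        have := h.logWidth m (R + s)
        simpa only [f, add_assoc] using this)).bind (c₂ := c ^ 3) (δ₂ := 3 * δ)
        (k := refineAtScale ν (m - R) a) (l := refineAtScale ν (m - R) a') fun j hj hj' =>
          hν.refineAtScale_close hc ha ha' h (m - R) j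
            (hwin (hA _ (hf ha) (hfN haN) j hj).1) (hwin (hA _ (hf ha') (hfN haN') j hj').1)
      convert this using 1
      · ring
      · push_cast; ring

lemma exists_iterate_logb_le_one (x : ℝ) : ∃ k : ℕ, (Real.logb 2)^[k] x ≤ 1 := by
  obtain ⟨n, hn⟩ := exists_nat_ge x
  induction n generalizing x with
  | zero => exact ⟨0, hn.trans (by simp)⟩
  | succ n ih =>
    by_cases hx : x ≤ 1
    · exact ⟨0, hx⟩
    · push Not at hx
      obtain ⟨k, hk⟩ := ih (Real.logb 2 x) (by
        rw [Real.logb_le_iff_le_rpow (by norm_num) (by linarith), Real.rpow_natCast]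
        refine hn.trans ?_
        exact_mod_cast Nat.lt_two_pow_self)
      exact ⟨k + 1, hk⟩

lemma iterate_logb_logStar_le_one (x : ℝ) : (Real.logb 2)^[logStar x] x ≤ 1 :=
  Nat.sInf_mem (exists_iterate_logb_le_one x)

lemma iterate_natLog_le_one (k : ℕ) (x : ℝ) (N : ℕ) (hN : (N : ℝ) ≤ x)
    (hx : (Real.logb 2)^[k] x ≤ 1) (hlt : ∀ i < k, 1 < (Real.logb 2)^[i] x) :
    (Nat.log 2)^[k] N ≤ 1 := by
  induction k generalizing x N with
  | zero => exact_mod_cast hN.trans hx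
  | succ k ih =>
    have hx1 : 1 < x := hlt 0 (Nat.succ_pos k)
    refine ih (Real.logb 2 x) (Nat.log 2 N) ?_ hx fun i hi => hlt (i + 1) (by omega)
    rcases Nat.eq_zero_or_pos N with rfl | hN0
    · simpa using (Real.logb_pos (by norm_num) hx1).le
    · exact (Real.natLog_le_logb N 2).trans (Real.logb_le_logb_of_le (by norm_num)
        (by exact_mod_cast hN0) hN)

lemma iterate_natLog_logStar_le_one {x : ℝ} {N : ℕ} (hN : (N : ℝ) ≤ x) :
    (Nat.log 2)^[logStar x] N ≤ 1 :=
  iterate_natLog_le_one _ x N hN (iterate_logb_logStar_le_one x) fun i hi => by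
    by_contra! h
    exact Nat.notMem_of_lt_sInf hi h

lemma one_le_logStar {x : ℝ} (hx : 1 < x) : 1 ≤ logStar x := by
  by_contra! h
  have := iterate_logb_logStar_le_one x
  rw [Nat.lt_one_iff.1 h] at this
  exact absurd this (not_le.2 hx)

section Grid

variable {d n p : ℕ}

lemma exists_mem_grid (d p : ℕ) : ∃ c : EuclideanSpace ℝ (Fin d), ∀ j, c j ∈ gridSet p :=
  ⟨0, fun _ => ⟨0, Nat.zero_le _, by simp⟩⟩

lemma gridSet_subset_Icc (hp : 2 ≤ p) : gridSet p ⊆ Set.Icc 0 1 := by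
  rintro x ⟨j, hj, rfl⟩
  have hp' : (0 : ℝ) < p - 1 := by
    have : (2 : ℝ) ≤ p := by exact_mod_cast hp
    linarith
  have hj' : (j : ℝ) ≤ p - 1 := by
    have : j + 1 ≤ p := by omega
    have : (j : ℝ) + 1 ≤ p := by exact_mod_cast this
    linarith
  exact ⟨by positivity, (div_le_one hp').2 hj'⟩

lemma dist_le_sqrt_of_mem_grid (hp : 2 ≤ p) {x y : EuclideanSpace ℝ (Fin d)}
    (hx : ∀ j, x j ∈ gridSet p) (hy : ∀ j, y j ∈ gridSet p) : dist x y ≤ Real.sqrt d := by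
  rw [EuclideanSpace.dist_eq]
  refine Real.sqrt_le_sqrt ?_
  calc ∑ i, dist (x i) (y i) ^ 2 ≤ ∑ _i : Fin d, (1 : ℝ) := by
        refine Finset.sum_le_sum fun i _ => ?_
        have h := Real.dist_le_of_mem_Icc_01 (gridSet_subset_Icc hp (hx i))
          (gridSet_subset_Icc hp (hy i))
        exact pow_le_one₀ dist_nonneg h
    _ = d := by simp

lemma eq_of_dist_lt_of_mem_grid (hp : 2 ≤ p) {x y : EuclideanSpace ℝ (Fin d)}
    (hx : ∀ j, x j ∈ gridSet p) (hy : ∀ j, y j ∈ gridSet p)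
    (h : dist x y * ((p : ℝ) - 1) < 1) : x = y := by
  have hp' : (0 : ℝ) < p - 1 := by
    have : (2 : ℝ) ≤ p := by exact_mod_cast hp
    linarith
  ext i
  obtain ⟨a, -, ha⟩ := hx i
  obtain ⟨b, -, hb⟩ := hy i
  have h1 : dist (x i) (y i) ≤ dist x y := by
    rw [dist_eq_norm, dist_eq_norm]
    exact PiLp.norm_apply_le (x - y) i
  have h2 : |(a : ℝ) - b| < 1 := by
    refine lt_of_le_of_lt ?_ h
    refine le_trans (le_of_eq ?_) (mul_le_mul_of_nonneg_right h1 hp'.le)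
    rw [ha, hb, Real.dist_eq, ← sub_div, abs_div, abs_of_pos hp', div_mul_cancel₀ _ hp'.ne']
  have h3 : |(a : ℤ) - b| < 1 := by exact_mod_cast h2
  have h4 : (a : ℤ) = b := by
    rw [Int.abs_lt_one_iff] at h3
    omega
  rw [ha, hb, show a = b by exact_mod_cast h4]

lemma ballCount_eq_of_forall {S : Fin n → EuclideanSpace ℝ (Fin d)}
    {c : EuclideanSpace ℝ (Fin d)} {r : ℝ} (h : ∀ i, dist (S i) c ≤ r) : ballCount S c r = n := by
  rw [ballCount, Nat.card_congr (Equiv.subtypeUnivEquiv h), Nat.card_fin]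

lemma ballCount_mono (S : Fin n → EuclideanSpace ℝ (Fin d)) (c : EuclideanSpace ℝ (Fin d)) :
    Monotone (ballCount S c) := by
  intro r r' h
  exact Nat.card_le_card_of_injective
    (Subtype.map id fun i hi => le_trans hi h) (Subtype.map_injective _ Function.injective_id)

lemma ballCount_le_add_one {S S' : Fin n → EuclideanSpace ℝ (Fin d)} {i₀ : Fin n}
    (h : ∀ j, j ≠ i₀ → S j = S' j) (c : EuclideanSpace ℝ (Fin d)) (r : ℝ) :
    ballCount S c r ≤ ballCount S' c r + 1 := by
  classical
  simp only [ballCount, Nat.card_eq_fintype_card, Fintype.card_subtype]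
  refine (Finset.card_le_card (t := insert i₀ (Finset.univ.filter fun i => dist (S' i) c ≤ r))
    ?_).trans (Finset.card_insert_le _ _)
  intro i hi
  by_cases hi0 : i = i₀
  · simp [hi0]
  · simp only [Finset.mem_filter, Finset.mem_univ, true_and] at hi
    simp [hi0, ← h i hi0, hi]

/-- The least multiple of the grid step (capped at `N` steps) that is the radius of a ball with
a grid centre containing at least `s` entries of `S`. -/
noncomputable def radiusIndex (p N : ℕ) (S : Fin n → EuclideanSpace ℝ (Fin d)) (s : ℤ) : ℕ :=
  sInf {i : ℕ | N ≤ i ∨ ∃ c : EuclideanSpace ℝ (Fin d), (∀ j, c j ∈ gridSet p) ∧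
    s ≤ ballCount S c ((i : ℝ) / ((p : ℝ) - 1))}

lemma radiusIndex_le (p N : ℕ) (S : Fin n → EuclideanSpace ℝ (Fin d)) (s : ℤ) :
    radiusIndex p N S s ≤ N := Nat.sInf_le (Or.inl le_rfl)

lemma radiusIndex_mem (p N : ℕ) (S : Fin n → EuclideanSpace ℝ (Fin d)) (s : ℤ) :
    N ≤ radiusIndex p N S s ∨ ∃ c : EuclideanSpace ℝ (Fin d), (∀ j, c j ∈ gridSet p) ∧
      s ≤ ballCount S c ((radiusIndex p N S s : ℝ) / ((p : ℝ) - 1)) :=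
  Nat.sInf_mem (s := {i : ℕ | N ≤ i ∨ ∃ c : EuclideanSpace ℝ (Fin d),
    (∀ j, c j ∈ gridSet p) ∧ s ≤ ballCount S c ((i : ℝ) / ((p : ℝ) - 1))}) ⟨N, Or.inl le_rfl⟩

lemma radiusIndex_mono (p N : ℕ) (S : Fin n → EuclideanSpace ℝ (Fin d)) :
    Monotone (radiusIndex p N S) := by
  intro s s' h
  refine Nat.sInf_le ((radiusIndex_mem p N S s').imp id ?_)
  rintro ⟨c, hc, hcount⟩
  exact ⟨c, hc, h.trans hcount⟩

lemma interleaved_radiusIndex (p N : ℕ) {S S' : Fin n → EuclideanSpace ℝ (Fin d)} {i₀ : Fin n}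
    (h : ∀ j, j ≠ i₀ → S j = S' j) : Interleaved (radiusIndex p N S) (radiusIndex p N S') := by
  have key : ∀ {S S' : Fin n → EuclideanSpace ℝ (Fin d)}, (∀ j, j ≠ i₀ → S j = S' j) →
      ∀ s, radiusIndex p N S s ≤ radiusIndex p N S' (s + 1) := by
    intro S S' h s
    refine Nat.sInf_le ((radiusIndex_mem p N S' (s + 1)).imp id ?_)
    rintro ⟨c, hc, hcount⟩
    have := ballCount_le_add_one (fun j hj => (h j hj).symm) c
      ((radiusIndex p N S' (s + 1) : ℝ) / ((p : ℝ) - 1))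
    exact ⟨c, hc, by omega⟩
  exact fun s => ⟨key h s, key (fun j hj => (h j hj).symm) s⟩

lemma radiusIndex_div_le (hp : 2 ≤ p) {N t : ℕ} {S : Fin n → EuclideanSpace ℝ (Fin d)}
    (hS : ∀ i j, S i j ∈ gridSet p) (htn : t ≤ n) :
    (radiusIndex p N S t : ℝ) / ((p : ℝ) - 1) ≤ 2 * rOpt p S t := by
  have hp' : (0 : ℝ) < p - 1 := by
    have : (2 : ℝ) ≤ p := by exact_mod_cast hp
    linarith
  suffices (radiusIndex p N S t : ℝ) / ((p : ℝ) - 1) / 2 ≤ rOpt p S t by linarith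
  refine le_csInf ?_ ?_
  · obtain ⟨c, hc⟩ := exists_mem_grid d p
    exact ⟨Real.sqrt d, Real.sqrt_nonneg _, c, hc, htn.trans_eq
      (ballCount_eq_of_forall fun i => dist_le_sqrt_of_mem_grid hp (hS i) hc).symm⟩
  · rintro r ⟨hr, c, hc, hcount⟩
    rw [div_le_iff₀ (by norm_num), div_le_iff₀ hp']
    rcases lt_or_ge (r * ((p : ℝ) - 1)) 1 with hlt | hge
    · have h0 : radiusIndex p N S t ≤ 0 := by
        refine Nat.sInf_le (Or.inr ⟨c, hc, ?_⟩)
        refine Int.ofNat_le.2 (hcount.trans ?_)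
        refine Nat.card_le_card_of_injective (Subtype.map id fun i hi => ?_)
          (Subtype.map_injective _ Function.injective_id)
        rw [id, eq_of_dist_lt_of_mem_grid hp (hS i) hc
          (lt_of_le_of_lt (mul_le_mul_of_nonneg_right hi hp'.le) hlt)]
        simp
      rw [Nat.le_zero.1 h0]
      have := mul_nonneg hr hp'.le
      simp only [Nat.cast_zero]
      linarith
    · have h1 : radiusIndex p N S t ≤ ⌈r * ((p : ℝ) - 1)⌉₊ := by
        refine Nat.sInf_le (Or.inr ⟨c, hc, Int.ofNat_le.2 (hcount.trans ?_)⟩)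
        refine ballCount_mono S c ?_
        rw [le_div_iff₀ hp']
        exact Nat.le_ceil _
      have h2 : (radiusIndex p N S t : ℝ) ≤ ⌈r * ((p : ℝ) - 1)⌉₊ := by exact_mod_cast h1
      have h3 := Nat.ceil_lt_add_one (mul_nonneg hr hp'.le)
      linarith

lemma exists_le_ballCount (hp : 2 ≤ p) {N t : ℕ} {S : Fin n → EuclideanSpace ℝ (Fin d)}
    (hS : ∀ i j, S i j ∈ gridSet p) (htn : t ≤ n) (hN : Real.sqrt d * ((p : ℝ) - 1) ≤ N) {s : ℤ}
    (hs : s ≤ t) {x : ℕ} (hx : radiusIndex p N S s ≤ x) :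
    ∃ c : EuclideanSpace ℝ (Fin d), (∀ j, c j ∈ gridSet p) ∧
      s ≤ ballCount S c ((x : ℝ) / ((p : ℝ) - 1)) := by
  have hp' : (0 : ℝ) < p - 1 := by
    have : (2 : ℝ) ≤ p := by exact_mod_cast hp
    linarith
  have hx' : (radiusIndex p N S s : ℝ) / ((p : ℝ) - 1) ≤ (x : ℝ) / ((p : ℝ) - 1) := by
    gcongr
  rcases radiusIndex_mem p N S s with h | ⟨c, hc, hcount⟩
  · obtain ⟨c, hc⟩ := exists_mem_grid d p
    refine ⟨c, hc, ?_⟩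
    rw [ballCount_eq_of_forall fun i => ?_]
    · omega
    · refine (dist_le_sqrt_of_mem_grid hp (hS i) hc).trans ?_
      rw [le_div_iff₀ hp']
      refine hN.trans ?_
      exact_mod_cast h.trans hx
  · exact ⟨c, hc, hcount.trans (by exact_mod_cast ballCount_mono S c hx')⟩

end Grid

lemma numLevels_le_of_pos {ε δ β : ℝ} (hε : 0 < ε) (hε1 : ε < 1) (hδ : 0 < δ) (hδ1 : δ < 1)
    (hβ : 0 < β) (hβ1 : β < 1) {k : ℕ} (hk : 1 ≤ k) :
    (numLevels ⌈4 * k / ε * Real.log (4 * k / δ)⌉₊ k : ℝ) ≤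
      4 * ((8 : ℝ) ^ k * (144 * k / ε) * Real.logb 2 (24 * k / (β * δ))) := by
  have hk' : (1 : ℝ) ≤ k := by exact_mod_cast hk
  set R := ⌈4 * k / ε * Real.log (4 * k / δ)⌉₊
  set l := Real.log (4 * k / δ)
  have hkδ : 4 ≤ 4 * k / δ := by
    rw [le_div_iff₀ hδ]
    nlinarith
  have hl : 1 ≤ l := by
    rw [Real.le_log_iff_exp_le (by linarith)]
    exact Real.exp_one_lt_d9.le.trans (by linarith)
  have hkε : 4 ≤ 4 * k / ε := by
    rw [le_div_iff₀ hε]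
    nlinarith
  have hR : (R : ℝ) ≤ 8 * k / ε * l := by
    have h1 := (Nat.ceil_lt_add_one (show 0 ≤ 4 * k / ε * l by positivity)).le
    have h2 : 1 ≤ 4 * k / ε * l := by nlinarith
    have h3 : 8 * k / ε * l = 4 * k / ε * l + 4 * k / ε * l := by ring
    linarith
  have hlog : l ≤ Real.logb 2 (24 * k / (β * δ)) := by
    have h1 : l ≤ Real.log (24 * k / (β * δ)) := by
      refine Real.log_le_log (by linarith) ?_
      refine div_le_div₀ (by positivity) (by linarith) (by positivity) ?_
      nlinarith
    refine h1.trans ?_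
    rw [Real.logb, le_div_iff₀ (Real.log_pos (by norm_num))]
    have := Real.log_two_lt_d9
    nlinarith
  have hG : (numLevels R k : ℝ) ≤ 2 ^ k * (8 * R) := by
    have := numLevels_le R k
    have h2 : numLevels R k ≤ 2 ^ k * (8 * R) := by omega
    exact_mod_cast h2
  calc (numLevels R k : ℝ) ≤ 2 ^ k * (8 * R) := hG
    _ ≤ 8 ^ k * (8 * (8 * k / ε * l)) := by gcongr; norm_num
    _ = 64 * (8 ^ k * (k / ε) * l) := by ring
    _ ≤ 576 * (8 ^ k * (k / ε) * l) := by gcongr; norm_num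
    _ = 4 * ((8 : ℝ) ^ k * (144 * k / ε) * l) := by ring
    _ ≤ 4 * ((8 : ℝ) ^ k * (144 * k / ε) * Real.logb 2 (24 * k / (β * δ))) := by gcongr

theorem good_radius (d p : ℕ) (hd : 1 ≤ d) (hp : 2 ≤ p)
    (ε δ β : ℝ) (hε : 0 < ε) (hε1 : ε < 1) (hδ : 0 < δ) (hδ1 : δ < 1)
    (hβ : 0 < β) (hβ1 : β < 1) (n t : ℕ) (ht : 1 ≤ t) (htn : t ≤ n) :
    ∃ M : (Fin n → EuclideanSpace ℝ (Fin d)) → Measure ℝ≥0,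
      (∀ S, IsProbabilityMeasure (M S)) ∧
      IsDPOn {x : EuclideanSpace ℝ (Fin d) | ∀ j, x j ∈ gridSet p} M ε δ ∧
      ∀ S : Fin n → EuclideanSpace ℝ (Fin d), (∀ i j, S i j ∈ gridSet p) →
        ENNReal.ofReal (1 - β) ≤
          M S {r : ℝ≥0 |
            (∃ c : EuclideanSpace ℝ (Fin d), (∀ j, c j ∈ gridSet p) ∧
              (t : ℝ) -
                  4 * ((8 : ℝ) ^ (logStar (2 * p * Real.sqrt d)) *
                    (144 * (logStar (2 * p * Real.sqrt d) : ℝ) / ε) *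
                    Real.logb 2 (24 * (logStar (2 * p * Real.sqrt d) : ℝ) / (β * δ))) -
                  (4 / ε) * Real.log (1 / β) ≤ (ballCount S c (r : ℝ) : ℝ)) ∧
            (r : ℝ) ≤ 4 * rOpt p S t} := by
  set k := logStar (2 * p * Real.sqrt d)
  have hp2 : (2 : ℝ) ≤ p := by exact_mod_cast hp
  have hd1 : 1 ≤ Real.sqrt d := Real.one_le_sqrt.2 (by exact_mod_cast hd)
  have hk : 1 ≤ k := one_le_logStar (by nlinarith)
  have hk' : (1 : ℝ) ≤ k := by exact_mod_cast hk
  set R := ⌈4 * k / ε * Real.log (4 * k / δ)⌉₊ with hR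
  set G := numLevels R k
  set N := ⌈Real.sqrt d * ((p : ℝ) - 1)⌉₊
  have hN : (N : ℝ) ≤ 2 * p * Real.sqrt d := by
    have := (Nat.ceil_lt_add_one (show 0 ≤ Real.sqrt d * ((p : ℝ) - 1) by
      nlinarith)).le
    nlinarith
  set c := ENNReal.ofReal (Real.exp (ε / (4 * k)))
  have hpow : ∀ m : ℕ, c ^ m = ENNReal.ofReal (Real.exp (m * (ε / (4 * k)))) := by
    intro m
    rw [Real.exp_nat_mul, ENNReal.ofReal_pow (Real.exp_pos _).le]
  have hc : 1 ≤ c := by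
    rw [ENNReal.one_le_ofReal]
    exact Real.one_le_exp (by positivity)
  obtain ⟨ν, hν⟩ := exists_isShiftNoise R c (ENNReal.ofReal (δ / (4 * k))) hc
    ENNReal.ofReal_ne_top (by
      rw [hpow, ← ENNReal.ofReal_inv_of_pos (Real.exp_pos _)]
      refine ENNReal.ofReal_le_ofReal ?_
      rw [← inv_div (4 * (k : ℝ)) δ]
      refine inv_anti₀ (show 0 < 4 * k / δ by positivity) ?_
      rw [← Real.log_le_iff_le_exp (show 0 < 4 * k / δ by positivity)]
      have h1 := Nat.le_ceil (4 * k / ε * Real.log (4 * k / δ))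
      rw [← hR] at h1
      calc Real.log (4 * k / δ) = 4 * k / ε * Real.log (4 * k / δ) * (ε / (4 * k)) := by
            field_simp
        _ ≤ R * (ε / (4 * k)) := by gcongr)
  obtain ⟨A, hA, hA'⟩ := exists_interior hν hc k N (iterate_natLog_logStar_le_one hN)
  let a : (Fin n → EuclideanSpace ℝ (Fin d)) → ℤ → ℕ := fun S z =>
    radiusIndex p N S ((t : ℤ) - G + z)
  have ha : ∀ S, Monotone (a S) := fun S y z hyz => radiusIndex_mono p N S (by omega)
  have haN : ∀ S s, a S s ≤ N := fun S s => radiusIndex_le p N S _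
  let r : ℕ → ℝ≥0 := fun x => Real.toNNReal ((x : ℝ) / ((p : ℝ) - 1))
  have hr : Measurable r := measurable_from_top
  have hr' : ∀ x, (r x : ℝ) = (x : ℝ) / ((p : ℝ) - 1) := fun x =>
    Real.coe_toNNReal _ (div_nonneg (Nat.cast_nonneg x) (by linarith))
  refine ⟨fun S => ((A (a S)).toMeasure).map r, fun S =>
    Measure.isProbabilityMeasure_map hr.aemeasurable, ?_, ?_⟩
  · rintro S S' - - ⟨i₀, -, hi₀⟩ T hT
    have hclose := hA' (a S) (a S') (ha S) (haN S) (ha S') (haN S') (fun s => by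
      have := interleaved_radiusIndex p N hi₀ ((t : ℤ) - G + s)
      simpa only [a, add_assoc] using this)
    have happly : ∀ q : PMF ℕ, q.toMeasure.map r T =
        ∑' x, q x * ((r ⁻¹' T).indicator 1 : ℕ → ℝ≥0∞) x := by
      intro q
      rw [Measure.map_apply hr hT, PMF.toMeasure_apply _ (hr hT)]
      refine tsum_congr fun x => ?_
      by_cases hx : x ∈ r ⁻¹' T
      · rw [Set.indicator_of_mem hx, Set.indicator_of_mem hx, Pi.one_apply, mul_one]
      · rw [Set.indicator_of_notMem hx, Set.indicator_of_notMem hx, mul_zero]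
    rw [happly, happly]
    refine (hclose _ fun x => Set.indicator_le_self' (fun _ _ => zero_le_one) x).trans ?_
    refine add_le_add (mul_le_mul' ?_ le_rfl) ?_
    · rw [hpow]
      refine ENNReal.ofReal_le_ofReal (Real.exp_le_exp.2 ?_)
      rw [mul_div_assoc', div_le_iff₀ (by positivity)]
      push_cast
      nlinarith
    · rw [← ENNReal.ofReal_natCast, ← ENNReal.ofReal_mul (by positivity)]
      refine ENNReal.ofReal_le_ofReal ?_
      rw [mul_div_assoc', div_le_iff₀ (by positivity)]
      push_cast
      nlinarith
  · intro S hS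
    refine (ENNReal.ofReal_le_one.2 (by linarith)).trans ?_
    have hsub : (A (a S)).support ⊆ {x | (∃ c : EuclideanSpace ℝ (Fin d),
        (∀ j, c j ∈ gridSet p) ∧ (t : ℝ) - G ≤ ballCount S c (r x)) ∧
        (r x : ℝ) ≤ 4 * rOpt p S t} := by
      intro x hx
      obtain ⟨hx0, hxG⟩ := hA (a S) (ha S) (haN S) x hx
      replace hxG : x ≤ radiusIndex p N S ((t : ℤ) - G + G) := hxG
      rw [sub_add_cancel] at hxG
      simp only [a, add_zero] at hx0
      have hx1 := radiusIndex_div_le (N := N) hp hS htn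
      have hx2 : (x : ℝ) / ((p : ℝ) - 1) ≤ (radiusIndex p N S t : ℝ) / ((p : ℝ) - 1) := by
        have : (x : ℝ) ≤ radiusIndex p N S t := by exact_mod_cast hxG
        exact div_le_div_of_nonneg_right this (by linarith)
      obtain ⟨c, hc, hcount⟩ := exists_le_ballCount hp hS htn (Nat.le_ceil _)
        (show (t : ℤ) - G ≤ t by omega) hx0
      have hpos : 0 ≤ (x : ℝ) / ((p : ℝ) - 1) := div_nonneg (Nat.cast_nonneg x) (by linarith)
      refine ⟨⟨c, hc, ?_⟩, ?_⟩
      · rw [hr']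
        exact_mod_cast hcount
      · rw [hr']
        linarith
    have hG := numLevels_le_of_pos hε hε1 hδ hδ1 hβ hβ1 hk
    have hlog : 0 ≤ 4 / ε * Real.log (1 / β) :=
      mul_nonneg (by positivity) (Real.log_nonneg (by rw [le_div_iff₀ hβ]; linarith))
    calc (1 : ℝ≥0∞) = (A (a S)).toMeasure (A (a S)).support :=
          (((A (a S)).toMeasure_apply_eq_one_iff (Set.to_countable _).measurableSet).2
            subset_rfl).symm
      _ ≤ (A (a S)).toMeasure (r ⁻¹' _) := measure_mono fun x hx => by
          obtain ⟨⟨c, hc, hcount⟩, hopt⟩ := hsub hx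
          exact ⟨⟨c, hc, by linarith⟩, hopt⟩
      _ ≤ _ := Measure.le_map_apply hr.aemeasurable _
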